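/- Let d ≥ 1. Let G ⊂ SL(2d+1, ℝ) be the group of block matrices of the form [[S, 0], [v, 1]], where S ∈ Sp(2d,ℝ) occupies the top-left 2d×2d block, v ∈ ℝ^{2d} is an arbitrary bottom row vector, and the bottom-right entry is 1. Then there is no G-invariant Borel probability measure on the Grassmannian Gr(ℝ^{2d+1}, 2) of 2-dimensional linear subspaces of ℝ^{2d+1}, where G acts by V ↦ g·V. -/

import Mathlib

open MeasureTheory Matrix

/-- Pairs of linearly independent vectors in `ℝ^n`. -/
abbrev GrPair (n : ℕ) := {p : (Fin n → ℝ) × (Fin n → ℝ) // LinearIndependent ℝ ![p.1, p.2]}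

/-- Two pairs are identified iff they span the same plane. -/
def grSetoid (n : ℕ) : Setoid (GrPair n) where
  r p q := Submodule.span ℝ {p.1.1, p.1.2} = Submodule.span ℝ {q.1.1, q.1.2}
  iseqv := ⟨fun _ => rfl, Eq.symm, Eq.trans⟩

/-- The Grassmannian `Gr(ℝ^n, 2)` of `2`-dimensional subspaces of `ℝ^n`, realized as the quotient
of the set of linearly independent pairs by the relation of having equal span, with the quotient
topology. -/
def Gr2 (n : ℕ) : Type := Quotient (grSetoid n)

instance (n : ℕ) : TopologicalSpace (Gr2 n) := instTopologicalSpaceQuotient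

instance (n : ℕ) : MeasurableSpace (Gr2 n) := borel (Gr2 n)

/-- The plane represented by a point of the Grassmannian. -/
def Gr2.toSubmodule {n : ℕ} : Gr2 n → Submodule ℝ (Fin n → ℝ) :=
  Quotient.lift (fun p : GrPair n => Submodule.span ℝ {p.1.1, p.1.2}) (fun _ _ h => h)

/-- The action of an injective matrix on the Grassmannian `Gr(ℝ^n, 2)`, `V ↦ S·V`. -/
noncomputable def grMap {n : ℕ} (S : Matrix (Fin n) (Fin n) ℝ)
    (hS : Function.Injective S.mulVecLin) : Gr2 n → Gr2 n :=
  Quotient.map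
    (fun p => ⟨(S.mulVec p.1.1, S.mulVec p.1.2), by
      have h : ![S.mulVec p.1.1, S.mulVec p.1.2] = S.mulVecLin ∘ ![p.1.1, p.1.2] := by
        funext i
        fin_cases i <;> simp [Matrix.mulVecLin_apply]
      rw [h]
      exact p.2.map' S.mulVecLin (LinearMap.ker_eq_bot.mpr hS)⟩)
    (fun a b hab => by
      have key : ∀ v w : Fin n → ℝ,
          Submodule.span ℝ {S.mulVec v, S.mulVec w} =
            Submodule.map S.mulVecLin (Submodule.span ℝ ({v, w} : Set (Fin n → ℝ))) := by
        intro v w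
        rw [Submodule.map_span]
        congr 1
        simp [Set.image_insert_eq, Matrix.mulVecLin_apply]
      show Submodule.span ℝ {S.mulVec a.1.1, S.mulVec a.1.2} =
        Submodule.span ℝ {S.mulVec b.1.1, S.mulVec b.1.2}
      rw [key, key]
      exact congrArg _ hab)

/-- The standard symplectic form matrix `J = [[0, I_d], [-I_d, 0]]` on `ℝ^{2d}` (with
`2d = d + d`). -/
noncomputable def Jstd (d : ℕ) : Matrix (Fin (d + d)) (Fin (d + d)) ℝ :=
  Matrix.reindex finSumFinEquiv finSumFinEquiv
    (Matrix.fromBlocks (0 : Matrix (Fin d) (Fin d) ℝ) 1 (-1) 0)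

/-- The `(2d+1) × (2d+1)` block matrix `[[S, 0], [v, 1]]`. -/
def extMat {d : ℕ} (S : Matrix (Fin (d + d)) (Fin (d + d)) ℝ) (v : Fin (d + d) → ℝ) :
    Matrix (Fin (d + d + 1)) (Fin (d + d + 1)) ℝ :=
  Matrix.of fun i j =>
    if hi : (i : ℕ) < d + d then
      if hj : (j : ℕ) < d + d then S ⟨i, hi⟩ ⟨j, hj⟩ else 0
    else
      if hj : (j : ℕ) < d + d then v ⟨j, hj⟩ else 1

instance (n : ℕ) : BorelSpace (Gr2 n) := ⟨rfl⟩

lemma Gr2.finrank_toSubmodule {n : ℕ} (V : Gr2 n) : Module.finrank ℝ V.toSubmodule = 2 := by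
  induction V using Quotient.inductionOn with
  | h p =>
    have h := finrank_span_eq_card p.2
    rw [Matrix.range_cons_cons_empty, Fintype.card_fin] at h
    exact h

lemma Gr2.isOpen_setOf_exists_mem {n : ℕ} {U : Set (Fin n → ℝ)} (hU : IsOpen U) :
    IsOpen {V : Gr2 n | ∃ z ∈ V.toSubmodule, z ∈ U} := by
  let mk : GrPair n → Gr2 n := Quotient.mk (grSetoid n)
  have hmk : Topology.IsQuotientMap mk := isQuotientMap_quot_mk
  refine hmk.isOpen_preimage.mp ?_
  have h : mk ⁻¹' {V : Gr2 n | ∃ z ∈ V.toSubmodule, z ∈ U} =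
      ⋃ c : ℝ × ℝ, {p : GrPair n | c.1 • p.1.1 + c.2 • p.1.2 ∈ U} := by
    ext p
    have hp : (mk p).toSubmodule = Submodule.span ℝ {p.1.1, p.1.2} := rfl
    simp only [Set.mem_preimage, Set.mem_ofPred_eq, Set.mem_iUnion, hp, Submodule.mem_span_pair,
      Prod.exists]
    grind
  rw [h]
  exact isOpen_iUnion fun c => hU.preimage (by fun_prop)

lemma continuous_grMap {n : ℕ} (S : Matrix (Fin n) (Fin n) ℝ)
    (hS : Function.Injective S.mulVecLin) : Continuous (grMap S hS) := by
  refine Continuous.quotient_map' (Continuous.subtype_mk ?_ _) _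
  fun_prop

lemma mulVec_mem_toSubmodule_grMap {n : ℕ} (S : Matrix (Fin n) (Fin n) ℝ)
    (hS : Function.Injective S.mulVecLin) {V : Gr2 n} {w : Fin n → ℝ} (hw : w ∈ V.toSubmodule) :
    S *ᵥ w ∈ (grMap S hS V).toSubmodule := by
  induction V using Quotient.inductionOn with
  | h p =>
    obtain ⟨a, b, rfl⟩ := Submodule.mem_span_pair.mp hw
    refine Submodule.mem_span_pair.mpr ⟨a, b, ?_⟩
    simp [Matrix.mulVec_add, Matrix.mulVec_smul]

lemma transvection_mulVec {n : ℕ} (i j : Fin n) (c : ℝ) (w : Fin n → ℝ) :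
    transvection i j c *ᵥ w = w + (c * w j) • Pi.single i 1 := by
  ext k
  simp [transvection, Matrix.add_mulVec, Matrix.single_mulVec, Pi.single_apply, Function.update_apply]

lemma injective_transvection {n : ℕ} {i j : Fin n} (hij : i ≠ j) (c : ℝ) :
    Function.Injective (transvection i j c).mulVecLin := by
  rw [Matrix.coe_mulVecLin]
  refine Matrix.mulVec_injective_of_isUnit ((Matrix.isUnit_iff_isUnit_det _).mpr ?_)
  simp [det_transvection_of_ne i j hij]

lemma add_smul_single_mem_iterate_grMap_transvection {n : ℕ} {i j : Fin n} (hij : i ≠ j)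
    {V : Gr2 n} {w : Fin n → ℝ} (hw : w ∈ V.toSubmodule) (k : ℕ) :
    w + (k * w j) • Pi.single i 1 ∈
      ((grMap (transvection i j 1) (injective_transvection hij 1))^[k] V).toSubmodule := by
  induction k with
  | zero => simpa using hw
  | succ k ih =>
    rw [Function.iterate_succ_apply']
    convert mulVec_mem_toSubmodule_grMap _ (injective_transvection hij 1) ih using 1
    rw [transvection_mulVec]
    ext l
    simp [Pi.single_apply, hij.symm]
    split_ifs <;> ring

/-- By Poincaré recurrence, a finite measure invariant under an elementary transvection is
carried by the planes which the transvection preserves. -/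
lemma ae_apply_eq_zero_or_single_mem {n : ℕ} {i j : Fin n} (hij : i ≠ j) (ν : Measure (Gr2 n))
    [IsFiniteMeasure ν] {S : Matrix (Fin n) (Fin n) ℝ} (hS : S = transvection i j 1)
    (hν : ∀ hinj : Function.Injective S.mulVecLin, Measure.map (grMap S hinj) ν = ν) :
    ∀ᵐ V ∂ν, (∀ w ∈ V.toSubmodule, w j = 0) ∨ Pi.single i 1 ∈ V.toSubmodule := by
  subst hS
  have hT : MeasurePreserving (grMap (transvection i j 1) (injective_transvection hij 1)) ν ν :=
    ⟨(continuous_grMap _ _).measurable, hν _⟩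
  let e : Fin n → ℝ := Pi.single i 1
  have hopen (m : ℕ) := Gr2.isOpen_setOf_exists_mem (Metric.isOpen_ball (x := e) (ε := 1 / (m + 1)))
  have hrec := ae_all_iff.mpr fun m : ℕ => hT.conservative.ae_mem_imp_frequently_image_mem
    (hopen m).measurableSet.compl.nullMeasurableSet
  filter_upwards [hrec] with V hV
  by_contra! hcon
  obtain ⟨⟨w, hw, hwj⟩, he⟩ := hcon
  obtain ⟨ε, hε, hball⟩ := Metric.isOpen_iff.mp
    V.toSubmodule.closed_of_finiteDimensional.isOpen_compl e he
  obtain ⟨m, hm⟩ := exists_nat_one_div_lt hε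
  refine hV m ?_ ?_
  · rintro ⟨z, hz, hze⟩
    exact hball (Metric.ball_subset_ball hm.le hze) hz
  have hlim : Filter.Tendsto (fun k : ℕ => e + (k * w j)⁻¹ • w) Filter.atTop (nhds e) := by
    have h : Filter.Tendsto (fun k : ℕ => (k * w j)⁻¹) Filter.atTop (nhds 0) := by
      simpa using (tendsto_inv_atTop_nhds_zero_nat (𝕜 := ℝ)).const_mul (w j)⁻¹
    simpa using tendsto_const_nhds.add (h.smul_const w)
  filter_upwards [hlim.eventually (Metric.ball_mem_nhds e (by positivity : (0 : ℝ) < 1 / (m + 1))),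
    Filter.eventually_gt_atTop 0] with k hk hk0
  refine not_not.mpr ⟨_, ?_, hk⟩
  have hne : (k * w j : ℝ) ≠ 0 := mul_ne_zero (by positivity) hwj
  convert Submodule.smul_mem _ (k * w j)⁻¹
    (add_smul_single_mem_iterate_grMap_transvection hij hw k) using 1
  rw [smul_add, inv_smul_smul₀ hne, add_comm]

lemma Gr2.exists_mem_apply_ne_zero {n : ℕ} (V : Gr2 n) (l : Fin n) :
    ∃ w ∈ V.toSubmodule, ∃ j ≠ l, w j ≠ 0 := by
  by_contra! h
  have hle : V.toSubmodule ≤ Submodule.span ℝ {Pi.single l 1} := by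
    intro w hw
    refine Submodule.mem_span_singleton.mpr ⟨w l, ?_⟩
    ext k
    by_cases hk : k = l
    · simp [hk]
    · simp [hk, h w hw k hk]
  have h1 := (Submodule.finrank_mono hle).trans (finrank_span_le_card _)
  simp only [Set.toFinset_singleton, Finset.card_singleton] at h1
  have h2 := V.finrank_toSubmodule
  omega

lemma Gr2.apply_eq_zero_of_single_mem {n : ℕ} {V : Gr2 n} {i j l : Fin n} (hij : i ≠ j)
    (hil : i ≠ l) (hjl : j ≠ l) (hi : Pi.single i 1 ∈ V.toSubmodule)
    (hl : Pi.single l 1 ∈ V.toSubmodule) {w : Fin n → ℝ} (hw : w ∈ V.toSubmodule) : w j = 0 := by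
  by_contra hwj
  have hli : LinearIndependent ℝ ![Pi.single i 1, Pi.single l 1, w] := by
    rw [Fintype.linearIndependent_iff]
    intro g hg
    simp only [Fin.sum_univ_three, Matrix.cons_val] at hg
    have h2 : g 2 = 0 := by
      have := congrFun hg j
      simpa [hij.symm, hjl, hwj] using this
    have h0 := congrFun hg i
    have h1 := congrFun hg l
    simp [h2, hil, hil.symm] at h0 h1
    intro k
    fin_cases k <;> assumption
  have hle : Submodule.span ℝ (Set.range ![Pi.single i 1, Pi.single l 1, w]) ≤ V.toSubmodule := by
    rw [Submodule.span_le, Set.range_subset_iff]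
    intro k
    fin_cases k <;> assumption
  have h1 := Submodule.finrank_mono hle
  rw [finrank_span_eq_card hli, V.finrank_toSubmodule] at h1
  simp at h1

lemma exists_ne_transvection_symplectic {d : ℕ} (j : Fin (d + d)) :
    ∃ i ≠ j, (transvection i j (1 : ℝ))ᵀ * Jstd d * transvection i j 1 = Jstd d := by
  let f : Fin d ⊕ Fin d ≃ Fin (d + d) := finSumFinEquiv
  have hJ (a b) : Jstd d (f a) (f b) = Matrix.fromBlocks 0 1 (-1) 0 a b := by
    simp only [Jstd, f, Matrix.reindex_apply, Matrix.submatrix_apply, Equiv.symm_apply_apply]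
  have hskew (k l) : Jstd d k l = -Jstd d l k := by
    obtain ⟨a, rfl⟩ := f.surjective k
    obtain ⟨b, rfl⟩ := f.surjective l
    rw [hJ, hJ]
    rcases a with a | a <;> rcases b with b | b <;> simp [Matrix.one_apply, eq_comm]
  obtain ⟨a, rfl⟩ := f.surjective j
  have hne : f a.swap ≠ f a := by rcases a with a | a <;> simp
  refine ⟨f a.swap, hne, ?_⟩
  have hrow (k) (hk : k ≠ f a) : Jstd d (f a.swap) k = 0 := by
    obtain ⟨b, rfl⟩ := f.surjective k
    rw [hJ]
    replace hk : b ≠ a := fun h => hk (congrArg f h)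
    rcases a with a | a <;> rcases b with b | b <;> simp [Matrix.one_apply] at hk ⊢ <;> grind
  generalize f a.swap = i at *
  generalize f a = j at *
  have hNJ : (single i j (1 : ℝ))ᵀ * Jstd d = single j j (Jstd d i j) := by
    rw [Matrix.transpose_single]
    ext k l
    by_cases hk : k = j
    · subst hk
      by_cases hl : l = k
      · simp [hl]
      · simp [Ne.symm hl, hrow l hl]
    · simp [hk, Ne.symm hk]
  have hJN : Jstd d * single i j (1 : ℝ) = -single j j (Jstd d i j) := by
    ext k l
    by_cases hl : l = j
    · subst hl
      by_cases hk : k = l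
      · simp [hk, hskew l i]
      · simp [Ne.symm hk, hskew k i, hrow k hk]
    · simp [hl, Ne.symm hl]
  rw [transvection, Matrix.transpose_add, Matrix.transpose_one, add_mul, one_mul, hNJ, mul_add,
    mul_one, add_mul, hJN, Matrix.single_mul_single_of_ne _ _ _ _ hne.symm]
  abel

lemma extMat_transvection {d : ℕ} (i j : Fin (d + d)) :
    extMat (transvection i j 1) 0 = transvection i.castSucc j.castSucc 1 := by
  ext k l
  refine Fin.lastCases ?_ (fun k => ?_) k <;> refine Fin.lastCases ?_ (fun l => ?_) l <;>
    simp [extMat, transvection, Matrix.one_apply, Matrix.single_apply, Fin.ext_iff] <;> grind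

lemma extMat_one_single {d : ℕ} (j : Fin (d + d)) :
    extMat 1 (Pi.single j 1) = transvection (Fin.last _) j.castSucc 1 := by
  ext k l
  refine Fin.lastCases ?_ (fun k => ?_) k <;> refine Fin.lastCases ?_ (fun l => ?_) l <;>
    simp [extMat, transvection, Matrix.one_apply, Matrix.single_apply, Pi.single_apply,
      Fin.ext_iff] <;> grind

/-- for `d ≥ 1`, let `G ⊂ SL(2d+1, ℝ)` be the group of block matrices
`[[S, 0], [v, 1]]` with `S ∈ Sp(2d,ℝ)` and `v ∈ ℝ^{2d}`. There is no `G`-invariant Borel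
probability measure on the Grassmannian `Gr(ℝ^{2d+1}, 2)`, where `g` acts by `V ↦ g·V`.
(Every element of `G` is invertible, so the injectivity hypothesis `hinj` is automatically
satisfiable.) -/
theorem no_parabolic_symplectic_invariant_measure_on_grassmannian (d : ℕ) (hd : 1 ≤ d) :
    ¬ ∃ ν : Measure (Gr2 (d + d + 1)), IsProbabilityMeasure ν ∧
      ∀ S : Matrix (Fin (d + d)) (Fin (d + d)) ℝ, Sᵀ * Jstd d * S = Jstd d →
        ∀ v : Fin (d + d) → ℝ,
          ∀ hinj : Function.Injective (extMat S v).mulVecLin,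
            Measure.map (grMap (extMat S v) hinj) ν = ν := by
  rintro ⟨ν, hprob, hinv⟩
  have hlast (j : Fin (d + d)) := ae_apply_eq_zero_or_single_mem (Fin.castSucc_lt_last j).ne' ν
    (extMat_one_single j) (hinv 1 (by simp) (Pi.single j 1))
  choose σ hσ hsymp using exists_ne_transvection_symplectic (d := d)
  have hne (j : Fin (d + d)) : (σ j).castSucc ≠ j.castSucc := by simpa using hσ j
  have htrans (j : Fin (d + d)) := ae_apply_eq_zero_or_single_mem (hne j) ν
    (extMat_transvection (σ j) j) (hinv _ (hsymp j) 0)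
  obtain ⟨V, hV, hV'⟩ := ((ae_all_iff.mpr hlast).and (ae_all_iff.mpr htrans)).exists
  obtain ⟨w, hw, j, hj, hwj⟩ := V.exists_mem_apply_ne_zero (Fin.last _)
  obtain ⟨j, rfl⟩ := Fin.exists_castSucc_eq.mpr hj
  refine hwj (Gr2.apply_eq_zero_of_single_mem (hne j) (Fin.castSucc_lt_last _).ne hj
    ((hV' j).resolve_left fun h => hwj (h w hw)) ((hV j).resolve_left fun h => hwj (h w hw)) hw)
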